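/- arXiv:2404.15167 — 2 statements merged into one kernel-verified Lean document; each statement's English description precedes it below -/
import Mathlib

section
/- Let r and m be integers with r ≥ 1 and m ≥ 2r, and let G_{r,m} be the graph obtained as follows: take a complete graph K_r, a path v₁ − v₂ − ⋯ − v_r on r vertices, and a complete bipartite graph K_{m,m}; join one vertex of K_r to v₁ by an edge, and join v_r to one vertex v of K_{m,m} by an edge. Then Gap(G_{r,m}) < 4/r³. -/
open Classical in
/-- Transition matrix of the simple random walk on `G`:
`P v w = 1/deg(v)` if `v ~ w`, else `0`. -/
noncomputable def transitionMatrix {V : Type*} [Fintype V] (G : SimpleGraph V) :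
    Matrix V V ℝ :=
  fun v w => if G.Adj v w then ((G.degree v : ℝ))⁻¹ else 0

/-- The second-largest eigenvalue of a matrix with real spectrum: the second-largest
root (with multiplicity) of its characteristic polynomial. -/
noncomputable def lambda2 {V : Type*} [Fintype V] [DecidableEq V] (M : Matrix V V ℝ) : ℝ :=
  (M.charpoly.roots.sort (· ≤ ·)).getD ((M.charpoly.roots.sort (· ≤ ·)).length - 2) 0

open Classical in
/-- Spectral gap of the random walk on `G`; by convention `0` if some vertex is isolated. -/
noncomputable def spectralGap {V : Type*} [Fintype V] (G : SimpleGraph V) : ℝ :=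
  if ∀ v, 0 < G.degree v then 1 - lambda2 (transitionMatrix G) else 0

/-- Base relation generating the graph `G_{r,m}`: a clique `K_r`, a path
`v₁ - ⋯ - v_r`, an edge from a vertex of `K_r` to `v₁`, an edge from `v_r` to a
vertex `v` of `K_{m,m}`, and the complete bipartite graph `K_{m,m}`. -/
def lollipopRel (r m : ℕ) :
    ((Fin r ⊕ Fin r) ⊕ (Fin m ⊕ Fin m)) → ((Fin r ⊕ Fin r) ⊕ (Fin m ⊕ Fin m)) → Prop :=
  fun x y =>
    match x, y with
    | Sum.inl (Sum.inl _), Sum.inl (Sum.inl _) => True            -- clique K_r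
    | Sum.inl (Sum.inr i), Sum.inl (Sum.inr j) => i.val + 1 = j.val -- path v₁-⋯-v_r
    | Sum.inl (Sum.inl a), Sum.inl (Sum.inr i) => a.val = 0 ∧ i.val = 0 -- K_r to v₁
    | Sum.inl (Sum.inr i), Sum.inr (Sum.inl b) => i.val = r - 1 ∧ b.val = 0 -- v_r to v
    | Sum.inr (Sum.inl _), Sum.inr (Sum.inr _) => True            -- K_{m,m}
    | _, _ => False

/-- The graph `G_{r,m}`: `K_{m,m}` with an attached lollipop `L_{r,r}`. -/
def lollipop (r m : ℕ) : SimpleGraph ((Fin r ⊕ Fin r) ⊕ (Fin m ⊕ Fin m)) :=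
  SimpleGraph.fromRel (lollipopRel r m)

open Matrix Finset

lemma lambda2_eq_eigenvalues₀ {V : Type*} [Fintype V] [DecidableEq V] {S : Matrix V V ℝ}
    (hS : S.IsHermitian) (hV : 1 < Fintype.card V) :
    lambda2 S = hS.eigenvalues₀ ⟨1, hV⟩ := by
  have hsort : S.charpoly.roots.sort (· ≤ ·) = (List.ofFn hS.eigenvalues₀).reverse := by
    refine List.Perm.eq_of_pairwise (le := (· ≤ ·)) (fun _ _ _ _ => le_antisymm)
      (Multiset.pairwise_sort _ _) ?_ ?_
    · rw [List.pairwise_reverse]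
      exact List.pairwise_ofFn.2 fun i j hij => hS.eigenvalues₀_antitone hij.le
    · rw [← Multiset.coe_eq_coe, Multiset.sort_eq, Multiset.coe_reverse,
        hS.roots_charpoly_eq_eigenvalues₀, Fin.univ_val_map]
      rfl
  unfold lambda2
  rw [hsort, List.getD_eq_getElem _ _ (by simp; omega)]
  simp only [List.getElem_reverse, List.getElem_ofFn, List.length_reverse, List.length_ofFn]
  congr 2
  omega

/-- All eigenvalues of a real symmetric matrix but one are at most `lambda2`. -/
lemma exists_forall_ne_eigenvalues_le_lambda2 {V : Type*} [Fintype V] [DecidableEq V]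
    {S : Matrix V V ℝ} (hS : S.IsHermitian) (hV : 1 < Fintype.card V) :
    ∃ i, ∀ j ≠ i, hS.eigenvalues j ≤ lambda2 S := by
  refine ⟨Fintype.equivOfCardEq (Fintype.card_fin _) ⟨0, by omega⟩, fun j hj => ?_⟩
  rw [lambda2_eq_eigenvalues₀ hS hV]
  refine hS.eigenvalues₀_antitone ?_
  rw [Fin.le_def]
  by_contra! hlt
  apply hj
  rw [← Equiv.symm_apply_eq]
  ext
  simpa using hlt

/-- The min-max principle for the second-largest eigenvalue: every pencil `a • u + b • v` contains
a nontrivial combination whose Rayleigh quotient is at most `lambda2`. -/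
lemma exists_rayleigh_le_lambda2 {V : Type*} [Fintype V] [DecidableEq V]
    {S : Matrix V V ℝ} (hS : S.IsHermitian) (hV : 1 < Fintype.card V) (u v : V → ℝ) :
    ∃ a b : ℝ, (a ≠ 0 ∨ b ≠ 0) ∧
      (a • u + b • v) ⬝ᵥ S *ᵥ (a • u + b • v) ≤
        lambda2 S * ((a • u + b • v) ⬝ᵥ (a • u + b • v)) := by
  obtain ⟨i, hi⟩ := exists_forall_ne_eigenvalues_le_lambda2 hS hV
  let e : V → V → ℝ := fun j => ⇑(hS.eigenvectorBasis j)
  have parseval (x y : V → ℝ) : x ⬝ᵥ y = ∑ j, (e j ⬝ᵥ x) * (e j ⬝ᵥ y) := by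
    have := hS.eigenvectorBasis.sum_inner_mul_inner (WithLp.toLp 2 x) (WithLp.toLp 2 y)
    simp only [EuclideanSpace.inner_eq_star_dotProduct, star_trivial] at this
    rw [dotProduct_comm x y, ← this]
    exact sum_congr rfl fun j _ => by rw [dotProduct_comm y]
  have eigen (j : V) (x : V → ℝ) : e j ⬝ᵥ S *ᵥ x = hS.eigenvalues j * (e j ⬝ᵥ x) := by
    have hT : Sᵀ = S := by simpa [IsHermitian, conjTranspose_eq_transpose_of_trivial] using hS
    rw [dotProduct_mulVec, ← mulVec_transpose, hT, hS.mulVec_eigenvectorBasis, smul_dotProduct,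
      smul_eq_mul]
  have bound (w : V → ℝ) (hw : e i ⬝ᵥ w = 0) : w ⬝ᵥ S *ᵥ w ≤ lambda2 S * (w ⬝ᵥ w) := by
    rw [parseval w (S *ᵥ w), parseval w w, mul_sum]
    refine sum_le_sum fun j _ => ?_
    rw [eigen]
    rcases eq_or_ne j i with rfl | hj
    · simp [hw]
    · nlinarith [mul_le_mul_of_nonneg_right (hi j hj) (mul_self_nonneg (e j ⬝ᵥ w))]
  by_cases hu : e i ⬝ᵥ u = 0
  · exact ⟨1, 0, by simp, bound _ (by simp [hu])⟩
  · refine ⟨e i ⬝ᵥ v, -(e i ⬝ᵥ u), Or.inr (neg_ne_zero.2 hu), bound _ ?_⟩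
    simp only [dotProduct_add, dotProduct_smul, smul_eq_mul]
    ring

open Classical in
/-- The symmetric matrix `D^{-1/2} A D^{-1/2}`, similar to the transition matrix. -/
noncomputable def normalizedAdjMatrix {V : Type*} [Fintype V] (G : SimpleGraph V) :
    Matrix V V ℝ :=
  fun x y => if G.Adj x y then (√(G.degree x : ℝ))⁻¹ * (√(G.degree y : ℝ))⁻¹ else 0

lemma isHermitian_normalizedAdjMatrix {V : Type*} [Fintype V] (G : SimpleGraph V) :
    (normalizedAdjMatrix G).IsHermitian := by
  ext x y
  by_cases h : G.Adj x y
  · simp [normalizedAdjMatrix, h, h.symm, mul_comm]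
  · have h' : ¬G.Adj y x := fun h' => h h'.symm
    simp [normalizedAdjMatrix, h, h']

open Classical in
lemma lambda2_transitionMatrix {V : Type*} [Fintype V] (G : SimpleGraph V)
    (hG : ∀ v, 0 < G.degree v) :
    lambda2 (transitionMatrix G) = lambda2 (normalizedAdjMatrix G) := by
  have hs (v : V) : √(G.degree v : ℝ) ≠ 0 := by
    have := hG v
    positivity
  let D : Matrix V V ℝ := diagonal fun v => √(G.degree v : ℝ)
  let D' : Matrix V V ℝ := diagonal fun v => (√(G.degree v : ℝ))⁻¹
  have hP : transitionMatrix G = D' * (normalizedAdjMatrix G * D) := by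
    ext x y
    simp only [D, D', diagonal_mul, mul_diagonal, normalizedAdjMatrix, transitionMatrix]
    split_ifs with h
    · rw [mul_assoc, inv_mul_cancel₀ (hs y), mul_one, ← mul_inv,
        Real.mul_self_sqrt (Nat.cast_nonneg _)]
    · simp
  have hD : D * D' = 1 := by
    simp [D, D', diagonal_mul_diagonal, mul_inv_cancel₀ (hs _)]
  unfold lambda2
  rw [hP, charpoly_mul_comm, mul_assoc, hD, mul_one]

open Classical in
/-- A test function bounds the spectral gap from above: the Dirichlet energy over ordered pairs
divided by twice the degree-weighted variance. -/
lemma spectralGap_lt_of_energy_lt {V : Type*} [Fintype V] [Nontrivial V] (G : SimpleGraph V)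
    (hG : ∀ v, 0 < G.degree v) (f : V → ℝ) {ε : ℝ} (hε : 0 < ε)
    (hf : ∀ a : ℝ, (∑ x, ∑ y, if G.Adj x y then (f x - f y) ^ 2 else 0) / 2
      < ε * ∑ x, (G.degree x : ℝ) * (f x + a) ^ 2) :
    spectralGap G < ε := by
  have hs (v : V) : √(G.degree v : ℝ) ≠ 0 := by
    have := hG v
    positivity
  rw [spectralGap, if_pos hG, lambda2_transitionMatrix G hG]
  by_contra! hgap
  obtain ⟨a, b, hab, hle⟩ := exists_rayleigh_le_lambda2 (isHermitian_normalizedAdjMatrix G)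
    Fintype.one_lt_card (fun v => √(G.degree v : ℝ)) (fun v => √(G.degree v : ℝ) * f v)
  set h : V → ℝ := fun v => a + b * f v with hh
  have hw : (a • (fun v => √(G.degree v : ℝ)) + b • (fun v => √(G.degree v : ℝ) * f v))
      = fun v => √(G.degree v : ℝ) * h v := by
    ext v
    simp only [Pi.add_apply, Pi.smul_apply, smul_eq_mul, hh]
    ring
  rw [hw] at hle
  have hnorm : (fun v => √(G.degree v : ℝ) * h v) ⬝ᵥ (fun v => √(G.degree v : ℝ) * h v)
      = ∑ v, (G.degree v : ℝ) * h v ^ 2 := by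
    refine sum_congr rfl fun v _ => ?_
    rw [mul_mul_mul_comm, Real.mul_self_sqrt (Nat.cast_nonneg _), sq]
  have hquad : (fun v => √(G.degree v : ℝ) * h v) ⬝ᵥ
      normalizedAdjMatrix G *ᵥ (fun v => √(G.degree v : ℝ) * h v)
      = ∑ x, ∑ y, if G.Adj x y then h x * h y else 0 := by
    simp only [dotProduct, mulVec, mul_sum]
    refine sum_congr rfl fun x _ => sum_congr rfl fun y _ => ?_
    simp only [normalizedAdjMatrix]
    split_ifs
    · have := hs x
      have := hs y
      field_simp
    · simp
  have henergy : (∑ x, ∑ y, if G.Adj x y then (h x - h y) ^ 2 else 0) / 2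
      = ∑ v, (G.degree v : ℝ) * h v ^ 2 - ∑ x, ∑ y, if G.Adj x y then h x * h y else 0 := by
    rw [← G.lapMatrix_toLinearMap₂' ℝ h, toLinearMap₂'_apply', SimpleGraph.lapMatrix, sub_mulVec,
      dotProduct_sub, SimpleGraph.dotProduct_mulVec_degMatrix,
      SimpleGraph.dotProduct_mulVec_adjMatrix]
    simp only [sq, mul_assoc]
  have hscale : (∑ x, ∑ y, if G.Adj x y then (h x - h y) ^ 2 else 0)
      = b ^ 2 * ∑ x, ∑ y, if G.Adj x y then (f x - f y) ^ 2 else 0 := by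
    simp only [mul_sum, mul_ite, mul_zero, hh]
    refine sum_congr rfl fun x _ => sum_congr rfl fun y _ => ?_
    split_ifs
    · ring
    · rfl
  rw [hnorm, hquad] at hle
  have hN : 0 ≤ ∑ v, (G.degree v : ℝ) * h v ^ 2 := sum_nonneg fun v _ => by positivity
  have key : ε * ∑ v, (G.degree v : ℝ) * h v ^ 2
      ≤ b ^ 2 * ((∑ x, ∑ y, if G.Adj x y then (f x - f y) ^ 2 else 0) / 2) := by
    nlinarith
  by_cases hb : b = 0
  · have ha : a ≠ 0 := hab.resolve_right (not_not.2 hb)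
    have : 0 < ∑ v, (G.degree v : ℝ) * h v ^ 2 := by
      refine sum_pos (fun v _ => ?_) univ_nonempty
      have := hG v
      simp only [hh, hb, zero_mul, add_zero]
      positivity
    rw [hb] at key
    nlinarith [mul_pos hε this]
  · have hN' : ∑ v, (G.degree v : ℝ) * h v ^ 2
        = b ^ 2 * ∑ v, (G.degree v : ℝ) * (f v + a / b) ^ 2 := by
      rw [mul_sum]
      refine sum_congr rfl fun v _ => ?_
      simp only [hh]
      field_simp
      ring
    rw [hN'] at key
    have := mul_lt_mul_of_pos_left (hf (a / b)) (by positivity : 0 < b ^ 2)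
    linarith

/-- The test function: constant on the clique, vanishing on `K_{m,m}`, linear in between. -/
def lollipopTest (r m : ℕ) : ((Fin r ⊕ Fin r) ⊕ (Fin m ⊕ Fin m)) → ℝ
  | Sum.inl (Sum.inl _) => r + 1
  | Sum.inl (Sum.inr i) => r - i.val
  | Sum.inr _ => 0

open Classical in
lemma energy_le_of_adj_imp {V : Type*} [Fintype V] (G : SimpleGraph V)
    (R : V → V → Prop) (hR : ∀ x y, G.Adj x y → R x y ∨ R y x) (f : V → ℝ) :
    (∑ x, ∑ y, if G.Adj x y then (f x - f y) ^ 2 else 0) / 2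
      ≤ ∑ x, ∑ y, if R x y then (f x - f y) ^ 2 else 0 := by
  have hle : (∑ x, ∑ y, if G.Adj x y then (f x - f y) ^ 2 else 0)
      ≤ ∑ x, ∑ y, ((if R x y then (f x - f y) ^ 2 else 0)
        + if R y x then (f y - f x) ^ 2 else 0) := by
    refine sum_le_sum fun x _ => sum_le_sum fun y _ => ?_
    have h1 := sq_nonneg (f x - f y)
    have h2 := sq_nonneg (f y - f x)
    by_cases h : G.Adj x y
    · rw [if_pos h]
      have hxy := hR x y h
      split_ifs <;> first | nlinarith | tauto
    · rw [if_neg h]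
      positivity
  simp only [sum_add_distrib] at hle
  rw [sum_comm (f := fun x y => if R y x then (f y - f x) ^ 2 else 0)] at hle
  linarith

open Classical in
lemma energy_lollipopTest_le (r m : ℕ) (hr : 1 ≤ r) (hm : 1 ≤ m) :
    (∑ x, ∑ y, if (lollipop r m).Adj x y then
      (lollipopTest r m x - lollipopTest r m y) ^ 2 else 0) / 2 ≤ (r : ℝ) + 2 := by
  refine (energy_le_of_adj_imp _ (lollipopRel r m)
    (fun x y h => ((SimpleGraph.fromRel_adj _ x y).1 h).2) _).trans ?_
  let E : ((Fin r ⊕ Fin r) ⊕ (Fin m ⊕ Fin m)) → ((Fin r ⊕ Fin r) ⊕ (Fin m ⊕ Fin m)) → ℝ :=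
    fun x y => if lollipopRel r m x y then (lollipopTest r m x - lollipopTest r m y) ^ 2 else 0
  change ∑ x, ∑ y, E x y ≤ _
  have hpath : ∑ i : Fin r, ∑ j : Fin r, E (.inl (.inr i)) (.inl (.inr j)) ≤ r := by
    have hrow (i : Fin r) : ∑ j : Fin r, E (.inl (.inr i)) (.inl (.inr j)) ≤ 1 := by
      by_cases h : i.val + 1 < r
      · rw [sum_eq_single ⟨i.val + 1, h⟩]
        · simp [E, lollipopRel, lollipopTest]
        · intro j _ hj
          exact if_neg fun hij : i.val + 1 = j.val => hj (Fin.ext hij.symm)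
        · simp
      · refine (sum_nonpos fun j _ => le_of_eq ?_).trans zero_le_one
        exact if_neg fun hij : i.val + 1 = j.val => by omega
    simpa using sum_le_sum fun i (_ : i ∈ univ) => hrow i
  have hfirst : ∑ a : Fin r, ∑ i : Fin r, E (.inl (.inl a)) (.inl (.inr i)) = 1 := by
    rw [sum_eq_single ⟨0, hr⟩, sum_eq_single ⟨0, hr⟩]
    · simp [E, lollipopRel, lollipopTest]
    · intro j _ hj
      exact if_neg fun h => hj (Fin.ext h.2)
    · simp
    · intro j _ hj
      exact sum_eq_zero fun i _ => if_neg fun h => hj (Fin.ext h.1)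
    · simp
  have hlast : ∑ i : Fin r, ∑ b : Fin m, E (.inl (.inr i)) (.inr (.inl b)) = 1 := by
    rw [sum_eq_single ⟨r - 1, by omega⟩, sum_eq_single ⟨0, hm⟩]
    · simp [E, lollipopRel, lollipopTest, Nat.cast_sub hr]
    · intro j _ hj
      exact if_neg fun h => hj (Fin.ext h.2)
    · simp
    · intro j _ hj
      exact sum_eq_zero fun i _ => if_neg fun h => hj (Fin.ext h.1)
    · simp
  have hclique (a b : Fin r) : E (.inl (.inl a)) (.inl (.inl b)) = 0 := by
    simp [E, lollipopTest]
  have hclique' (a : Fin r) (z : Fin m ⊕ Fin m) : E (.inl (.inl a)) (.inr z) = 0 :=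
    if_neg (by simp [lollipopRel])
  have hback (i a : Fin r) : E (.inl (.inr i)) (.inl (.inl a)) = 0 :=
    if_neg (by simp [lollipopRel])
  have hlast' (i : Fin r) (c : Fin m) : E (.inl (.inr i)) (.inr (.inr c)) = 0 :=
    if_neg (by simp [lollipopRel])
  have hbip (z : Fin m ⊕ Fin m) (x : Fin r ⊕ Fin r) : E (.inr z) (.inl x) = 0 :=
    if_neg (by rcases z with z | z <;> simp [lollipopRel])
  have hbip' (z w : Fin m ⊕ Fin m) : E (.inr z) (.inr w) = 0 := by
    simp [E, lollipopTest]
  simp only [Fintype.sum_sum_type, sum_add_distrib, hfirst, hlast, hclique, hclique', hback,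
    hlast', hbip, hbip', sum_const_zero]
  linarith

open Classical in
lemma le_degree_lollipop_clique (r m : ℕ) (a : Fin r) :
    r - 1 ≤ (lollipop r m).degree (Sum.inl (Sum.inl a)) := by
  rw [← SimpleGraph.card_neighborFinset_eq_degree]
  calc r - 1 = #((univ.erase a).image (Sum.inl ∘ Sum.inl : _ → (Fin r ⊕ Fin r) ⊕ (Fin m ⊕ Fin m))) := by
        rw [card_image_of_injective _ (Sum.inl_injective.comp Sum.inl_injective)]
        simp
    _ ≤ _ := card_le_card fun x hx => by
        obtain ⟨b, hb, rfl⟩ := mem_image.1 hx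
        rw [SimpleGraph.mem_neighborFinset, lollipop, SimpleGraph.fromRel_adj]
        simpa [lollipopRel, eq_comm] using hb

open Classical in
lemma le_degree_lollipop_bipartite (r m : ℕ) (z : Fin m ⊕ Fin m) :
    m ≤ (lollipop r m).degree (Sum.inr z) := by
  rw [← SimpleGraph.card_neighborFinset_eq_degree]
  rcases z with b | b
  · calc m = #(univ.image (Sum.inr ∘ Sum.inr : _ → (Fin r ⊕ Fin r) ⊕ (Fin m ⊕ Fin m))) := by
          rw [card_image_of_injective _ (Sum.inr_injective.comp Sum.inr_injective)]
          simp
      _ ≤ _ := card_le_card fun x hx => by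
          obtain ⟨c, -, rfl⟩ := mem_image.1 hx
          rw [SimpleGraph.mem_neighborFinset, lollipop, SimpleGraph.fromRel_adj]
          simp [lollipopRel]
  · calc m = #(univ.image (Sum.inr ∘ Sum.inl : _ → (Fin r ⊕ Fin r) ⊕ (Fin m ⊕ Fin m))) := by
          rw [card_image_of_injective _ (Sum.inr_injective.comp Sum.inl_injective)]
          simp
      _ ≤ _ := card_le_card fun x hx => by
          obtain ⟨c, -, rfl⟩ := mem_image.1 hx
          rw [SimpleGraph.mem_neighborFinset, lollipop, SimpleGraph.fromRel_adj]
          simp [lollipopRel]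

open Classical in
lemma le_weighted_norm_lollipopTest (r m : ℕ) (hm : 2 * r ≤ m)
    (hG : ∀ v, 0 < (lollipop r m).degree v) (a : ℝ) :
    (r : ℝ) ^ 2 / 2 * (r + 1 + a) ^ 2 + 8 * r ^ 2 * a ^ 2
      ≤ ∑ x, ((lollipop r m).degree x : ℝ) * (lollipopTest r m x + a) ^ 2 := by
  rw [Fintype.sum_sum_type, Fintype.sum_sum_type]
  have hclique : (r : ℝ) ^ 2 / 2 * (r + 1 + a) ^ 2 ≤ ∑ i : Fin r,
      ((lollipop r m).degree (Sum.inl (Sum.inl i)) : ℝ)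
        * (lollipopTest r m (Sum.inl (Sum.inl i)) + a) ^ 2 := by
    calc (r : ℝ) ^ 2 / 2 * (r + 1 + a) ^ 2
        = ∑ _i : Fin r, (r : ℝ) / 2 * (r + 1 + a) ^ 2 := by
          simp
          ring
      _ ≤ _ := sum_le_sum fun i _ => by
          refine mul_le_mul_of_nonneg_right ?_ (sq_nonneg _)
          have h1 := le_degree_lollipop_clique r m i
          have h2 := hG (Sum.inl (Sum.inl i))
          have h3 : r ≤ 2 * (lollipop r m).degree (Sum.inl (Sum.inl i)) := by omega
          have h4 : (r : ℝ) ≤ 2 * (lollipop r m).degree (Sum.inl (Sum.inl i)) := by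
            exact_mod_cast h3
          linarith
  have hpath : 0 ≤ ∑ i : Fin r, ((lollipop r m).degree (Sum.inl (Sum.inr i)) : ℝ)
      * (lollipopTest r m (Sum.inl (Sum.inr i)) + a) ^ 2 :=
    sum_nonneg fun i _ => by positivity
  have hbip : 8 * (r : ℝ) ^ 2 * a ^ 2 ≤ ∑ z : Fin m ⊕ Fin m,
      ((lollipop r m).degree (Sum.inr z) : ℝ) * (lollipopTest r m (Sum.inr z) + a) ^ 2 := by
    have hm' : 2 * (r : ℝ) ≤ m := by exact_mod_cast hm
    calc 8 * (r : ℝ) ^ 2 * a ^ 2 ≤ 2 * (m : ℝ) ^ 2 * a ^ 2 := by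
          refine mul_le_mul_of_nonneg_right ?_ (sq_nonneg _)
          have hr0 : (0 : ℝ) ≤ r := r.cast_nonneg
          nlinarith
      _ = ∑ _z : Fin m ⊕ Fin m, (m : ℝ) * a ^ 2 := by
          simp
          ring
      _ ≤ _ := sum_le_sum fun z _ => by
          have h : (m : ℝ) ≤ (lollipop r m).degree (Sum.inr z) := by
            exact_mod_cast le_degree_lollipop_bipartite r m z
          simpa [lollipopTest] using mul_le_mul_of_nonneg_right h (sq_nonneg a)
  linarith

/-- **Lemma 6.1.** For `r ≥ 1` and `m ≥ 2r`, `Gap(G_{r,m}) < 4/r³`. -/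
theorem gap_lollipop_lt (r m : ℕ) (hr : 1 ≤ r) (hm : 2 * r ≤ m) :
    spectralGap (lollipop r m) < 4 / (r : ℝ) ^ 3 := by
  classical
  have hr0 : (0 : ℝ) < r := by exact_mod_cast hr
  have hε : 0 < 4 / (r : ℝ) ^ 3 := by positivity
  by_cases hG : ∀ v, 0 < (lollipop r m).degree v
  · have : Nontrivial ((Fin r ⊕ Fin r) ⊕ (Fin m ⊕ Fin m)) :=
      ⟨Sum.inl (Sum.inl ⟨0, hr⟩), Sum.inl (Sum.inr ⟨0, hr⟩), by simp⟩
    refine spectralGap_lt_of_energy_lt _ hG (lollipopTest r m) hε fun a => ?_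
    refine (energy_lollipopTest_le r m hr (by omega)).trans_lt ?_
    refine lt_of_lt_of_le ?_
      (mul_le_mul_of_nonneg_left (le_weighted_norm_lollipopTest r m hm hG a) hε.le)
    have hvar : 8 / 17 * ((r : ℝ) + 1) ^ 2 ≤ (r + 1 + a) ^ 2 / 2 + 8 * a ^ 2 := by
      nlinarith [sq_nonneg (17 * a + (r + 1))]
    rw [div_mul_eq_mul_div, lt_div_iff₀ (by positivity)]
    have hpos : (0 : ℝ) < r ^ 2 := by positivity
    have h1 : ((r : ℝ) + 2) * r < 4 * (8 / 17 * (r + 1) ^ 2) := by nlinarith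
    nlinarith [mul_lt_mul_of_pos_left (h1.trans_le
      (mul_le_mul_of_nonneg_left hvar (by norm_num))) hpos]
  · rwa [spectralGap, if_neg hG]
end

section
/- Let r and m be integers with r ≥ 1 and m ≥ 2r, and let G_{r,m} be the graph obtained as follows: take a complete graph K_r, a path v₁ − v₂ − ⋯ − v_r on r vertices, and a complete bipartite graph K_{m,m}; join one vertex of K_r to v₁ by an edge, and join v_r to one vertex v of K_{m,m} by an edge. Then the complement of G_{r,m} satisfies Gap(complement of G_{r,m}) ≤ 4r/m. -/
open Matrix

/-- If a symmetric real matrix has Rayleigh quotient at least `c` on the plane spanned by two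
linearly independent vectors, then its second-largest eigenvalue is at least `c`. -/
theorem le_lambda2_of_isHermitian {V : Type*} [Fintype V] [DecidableEq V] {S : Matrix V V ℝ}
    (hS : S.IsHermitian) {c : ℝ} {x y : V → ℝ} (hxy : LinearIndependent ℝ ![x, y])
    (hc : ∀ a b : ℝ, c * ((a • x + b • y) ⬝ᵥ (a • x + b • y)) ≤
      (a • x + b • y) ⬝ᵥ (S *ᵥ (a • x + b • y))) :
    c ≤ lambda2 S := by
  by_contra! hlt
  have hcardV : 2 ≤ Fintype.card V := by
    simpa using hxy.fintype_card_le_finrank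
  -- At most one eigenvalue is at least `c`.
  have hcard : (Finset.univ.filter fun i => c ≤ hS.eigenvalues i).card ≤ 1 := by
    unfold lambda2 at hlt
    set l := S.charpoly.roots.sort (· ≤ ·) with hl
    have hroots : S.charpoly.roots = Multiset.map hS.eigenvalues Finset.univ.val := by
      simpa using hS.roots_charpoly_eq_eigenvalues
    have hlen : l.length = Fintype.card V := by
      rw [hl, Multiset.length_sort, hroots]; simp
    have hcount : l.countP (fun t => decide (c ≤ t)) =
        (Finset.univ.filter fun i => c ≤ hS.eigenvalues i).card := by
      rw [← Multiset.coe_countP, hl, Multiset.sort_eq, hroots, Multiset.countP_map]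
      rfl
    rw [← hcount, ← List.take_append_drop (l.length - 1) l, List.countP_append]
    have hdrop : (l.drop (l.length - 1)).countP (fun t => decide (c ≤ t)) ≤ 1 :=
      List.countP_le_length.trans (by rw [List.length_drop]; omega)
    have htake : (l.take (l.length - 1)).countP (fun t => decide (c ≤ t)) = 0 := by
      rw [List.countP_eq_zero]
      intro t ht
      obtain ⟨k, hk, rfl⟩ := List.mem_iff_getElem.1 ht
      rw [List.length_take] at hk
      have hle : l[k]'(by omega) ≤ l[l.length - 2]'(by omega) :=
        (Multiset.pairwise_sort S.charpoly.roots (· ≤ ·)).sortedLE.getElem_le_getElem_of_le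
          (by omega)
      rw [List.getD_eq_getElem _ _ (by omega)] at hlt
      simpa using hle.trans_lt hlt
    omega
  have : Nonempty V := Fintype.card_pos_iff.1 (by omega)
  obtain ⟨i₀, hi₀⟩ : ∃ i₀, ∀ j, j ≠ i₀ → hS.eigenvalues j < c := by
    rw [Finset.card_le_one_iff_subset_singleton] at hcard
    obtain ⟨i₀, h⟩ := hcard
    refine ⟨i₀, fun j hj => lt_of_not_ge fun hcj => hj ?_⟩
    simpa using h (show j ∈ _ by simpa using hcj)
  set U : Matrix V V ℝ := hS.eigenvectorUnitary.1
  have hUU : U * Uᵀ = 1 := Unitary.coe_mul_star_self hS.eigenvectorUnitary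
  have hspec : S = U * diagonal hS.eigenvalues * Uᵀ := hS.spectral_theorem
  -- A nonzero vector of the plane is orthogonal to the exceptional eigenvector.
  obtain ⟨a, b, hab, hker⟩ : ∃ a b : ℝ, ¬(a = 0 ∧ b = 0) ∧ (Uᵀ *ᵥ (a • x + b • y)) i₀ = 0 := by
    simp only [mulVec_add, mulVec_smul, Pi.add_apply, Pi.smul_apply, smul_eq_mul]
    by_cases h : (Uᵀ *ᵥ x) i₀ = 0
    · exact ⟨1, 0, by simp, by simp [h]⟩
    · exact ⟨-(Uᵀ *ᵥ y) i₀, (Uᵀ *ᵥ x) i₀, fun h' => h h'.2, by ring⟩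
  refine hab (LinearIndependent.pair_iff.1 hxy a b ?_)
  have hq := hc a b
  set z := a • x + b • y
  have hz : z = U *ᵥ (Uᵀ *ᵥ z) := by rw [mulVec_mulVec, hUU, one_mulVec]
  have hnorm : z ⬝ᵥ z = ∑ i, (Uᵀ *ᵥ z) i ^ 2 := by
    conv_lhs => rw [hz, dotProduct_mulVec, ← mulVec_transpose, ← hz]
    simp [dotProduct, sq]
  have hform : z ⬝ᵥ (S *ᵥ z) = ∑ i, hS.eigenvalues i * (Uᵀ *ᵥ z) i ^ 2 := by
    rw [show S *ᵥ z = _ from congrArg (· *ᵥ z) hspec, ← mulVec_mulVec, ← mulVec_mulVec,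
      dotProduct_mulVec, ← mulVec_transpose]
    simp only [dotProduct, mulVec_diagonal]
    exact Finset.sum_congr rfl fun i _ => by ring
  rw [hnorm, hform, Finset.mul_sum] at hq
  have hterm : ∀ i ∈ Finset.univ,
      hS.eigenvalues i * (Uᵀ *ᵥ z) i ^ 2 ≤ c * (Uᵀ *ᵥ z) i ^ 2 := by
    intro i _
    by_cases hi : i = i₀
    · simp [hi, hker]
    · exact mul_le_mul_of_nonneg_right (hi₀ i hi).le (sq_nonneg _)
  have hzero : Uᵀ *ᵥ z = 0 := by
    funext i
    by_cases hi : i = i₀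
    · simpa [hi] using hker
    · have heq := (Finset.sum_eq_sum_iff_of_le hterm).1
        (le_antisymm (Finset.sum_le_sum hterm) hq) i (Finset.mem_univ i)
      have : (hS.eigenvalues i - c) * (Uᵀ *ᵥ z) i ^ 2 = 0 := by linarith
      simpa [sub_ne_zero.2 (hi₀ i hi).ne] using this
  rw [hz, hzero, mulVec_zero]

/-- Variational lower bound for the second-largest eigenvalue of the simple random walk: a lower
bound for the Rayleigh quotient on the plane spanned by two linearly independent functions. -/
theorem le_lambda2_transitionMatrix {V : Type*} [Fintype V] [DecidableEq V] (G : SimpleGraph V)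
    [DecidableRel G.Adj] (hdeg : ∀ v, 0 < G.degree v) {c : ℝ} {f g : V → ℝ}
    (hfg : LinearIndependent ℝ ![f, g])
    (hc : ∀ a b : ℝ, c * ∑ v, (G.degree v : ℝ) * (a • f + b • g) v ^ 2 ≤
      (a • f + b • g) ⬝ᵥ (G.adjMatrix ℝ *ᵥ (a • f + b • g))) :
    c ≤ lambda2 (transitionMatrix G) := by
  have hpos : ∀ v, 0 < √(G.degree v : ℝ) := fun v => Real.sqrt_pos.2 (by exact_mod_cast hdeg v)
  let D : Matrix V V ℝ := diagonal fun v => √(G.degree v : ℝ)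
  let E : Matrix V V ℝ := diagonal fun v => (√(G.degree v : ℝ))⁻¹
  have hP : transitionMatrix G = E * (E * G.adjMatrix ℝ) := by
    ext v w
    have hsq : (√(G.degree v : ℝ))⁻¹ * (√(G.degree v : ℝ))⁻¹ = (G.degree v : ℝ)⁻¹ := by
      rw [← mul_inv, Real.mul_self_sqrt (Nat.cast_nonneg _)]
    simp only [transitionMatrix, E, diagonal_mul, SimpleGraph.adjMatrix_apply]
    rw [← mul_assoc, hsq, mul_ite, mul_one, mul_zero]
    congr!
  have hS : (E * G.adjMatrix ℝ * E).IsHermitian := by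
    simp [IsHermitian, E, mul_assoc, conjTranspose_eq_transpose_of_trivial]
  have hlam : lambda2 (transitionMatrix G) = lambda2 (E * G.adjMatrix ℝ * E) := by
    unfold lambda2
    rw [hP, charpoly_mul_comm]
  have hED : E * D = 1 := by
    rw [diagonal_mul_diagonal, ← diagonal_one]
    congr 1
    funext v
    exact inv_mul_cancel₀ (hpos v).ne'
  have hlin : ∀ a b : ℝ, a • (D *ᵥ f) + b • (D *ᵥ g) = D *ᵥ (a • f + b • g) := by
    intro a b
    rw [mulVec_add, mulVec_smul, mulVec_smul]
  rw [hlam]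
  refine le_lambda2_of_isHermitian hS (x := D *ᵥ f) (y := D *ᵥ g) ?_ fun a b => ?_
  · rw [LinearIndependent.pair_iff] at hfg ⊢
    intro a b hab
    refine hfg a b ?_
    rw [← one_mulVec (a • f + b • g), ← hED, ← mulVec_mulVec, ← hlin, hab, mulVec_zero]
  · rw [hlin]
    have hab := hc a b
    set h := a • f + b • g
    have hnorm : (D *ᵥ h) ⬝ᵥ (D *ᵥ h) = ∑ v, (G.degree v : ℝ) * h v ^ 2 := by
      simp only [dotProduct, D, mulVec_diagonal]
      refine Finset.sum_congr rfl fun v _ => ?_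
      rw [mul_mul_mul_comm, Real.mul_self_sqrt (Nat.cast_nonneg _), sq]
    have hEt : Eᵀ = E := diagonal_transpose _
    have hform : (D *ᵥ h) ⬝ᵥ ((E * G.adjMatrix ℝ * E) *ᵥ (D *ᵥ h)) =
        h ⬝ᵥ (G.adjMatrix ℝ *ᵥ h) := by
      rw [mulVec_mulVec, mul_assoc, hED, mul_one, ← mulVec_mulVec, dotProduct_mulVec,
        ← mulVec_transpose, hEt, mulVec_mulVec, hED, one_mulVec]
    rwa [hnorm, hform]

/-- Variational upper bound for the spectral gap of the simple random walk. -/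
theorem spectralGap_le {V : Type*} [Fintype V] (G : SimpleGraph V) [DecidableRel G.Adj] {c : ℝ}
    (hc1 : c ≤ 1) {f g : V → ℝ} (hfg : LinearIndependent ℝ ![f, g])
    (hc : ∀ a b : ℝ, c * ∑ v, (G.degree v : ℝ) * (a • f + b • g) v ^ 2 ≤
      (a • f + b • g) ⬝ᵥ (G.adjMatrix ℝ *ᵥ (a • f + b • g))) :
    spectralGap G ≤ 1 - c := by
  classical
  unfold spectralGap
  split_ifs with hdeg
  · exact sub_le_sub_left
      (le_lambda2_transitionMatrix G (fun v => by convert hdeg v) hfg hc) 1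
  · linarith

/-- Two vertices of `K_{m,m}` are adjacent in the complement of `G_{r,m}` iff they are distinct and
belong to the same part. -/
theorem lollipop_compl_adj_inr_inr {r m : ℕ} {v w : Fin m ⊕ Fin m} :
    (lollipop r m)ᶜ.Adj (Sum.inr v) (Sum.inr w) ↔ v ≠ w ∧ v.isLeft = w.isLeft := by
  rcases v with v | v <;> rcases w with w | w <;> simp [lollipop, lollipopRel]

/-- In the complement of `G_{r,m}`, a vertex of `K_{m,m}` is adjacent to at most the `2r` lollipop
vertices and the `m - 1` other vertices of its part. -/
theorem degree_lollipop_compl_le (r m : ℕ) [DecidableRel (lollipop r m)ᶜ.Adj] (v : Fin m ⊕ Fin m) :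
    ((lollipop r m)ᶜ.degree (Sum.inr v) : ℝ) ≤ m - 1 + 2 * r := by
  classical
  let s : Finset (Fin m ⊕ Fin m) := Finset.univ.filter fun w => w.isLeft = v.isLeft
  have hs : s.card = m := by
    rw [Finset.card_filter, Fintype.sum_sum_type]
    rcases v with v | v <;> simp
  have hsub : (lollipop r m)ᶜ.neighborFinset (Sum.inr v) ⊆
      (Finset.univ : Finset (Fin r ⊕ Fin r)).disjSum (s.erase v) := by
    intro w hw
    rw [SimpleGraph.mem_neighborFinset] at hw
    rcases w with w | w
    · simp
    · rw [lollipop_compl_adj_inr_inr] at hw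
      simpa [s] using And.intro hw.1.symm hw.2.symm
  have hcard := Finset.card_le_card hsub
  have hv : v ∈ s := by simp [s]
  rw [SimpleGraph.card_neighborFinset_eq_degree, Finset.card_disjSum,
    Finset.card_erase_of_mem hv, hs] at hcard
  have hm : 1 ≤ m := hs ▸ Finset.card_pos.2 ⟨v, hv⟩
  simp only [Finset.card_univ, Fintype.card_sum, Fintype.card_fin] at hcard
  have : ((lollipop r m)ᶜ.degree (Sum.inr v) + 1 : ℝ) ≤ m + 2 * r := by
    exact_mod_cast (by omega : (lollipop r m)ᶜ.degree (Sum.inr v) + 1 ≤ m + 2 * r)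
  linarith

/-- **Equation (6.2).** For `r ≥ 1` and `m ≥ 2r`, the complement of `G_{r,m}`
satisfies `Gap(complement of G_{r,m}) ≤ 4r/m`. -/
theorem gap_lollipop_compl_le (r m : ℕ) (hr : 1 ≤ r) (hm : 2 * r ≤ m) :
    spectralGap (lollipop r m)ᶜ ≤ 4 * (r : ℝ) / m := by
  classical
  have hr' : (1 : ℝ) ≤ r := by exact_mod_cast hr
  have hm' : 2 * (r : ℝ) ≤ m := by exact_mod_cast hm
  have hden : (0 : ℝ) < m - 1 + 2 * r := by linarith
  have hc0 : 0 ≤ ((m : ℝ) - 1) / (m - 1 + 2 * r) := div_nonneg (by linarith) hden.le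
  have hgap : 1 - ((m : ℝ) - 1) / (m - 1 + 2 * r) ≤ 4 * r / m := by
    rw [one_sub_div hden.ne', div_le_div_iff₀ hden (by linarith)]
    nlinarith
  let i₀ : Fin m := ⟨0, by omega⟩
  let f : (Fin r ⊕ Fin r) ⊕ (Fin m ⊕ Fin m) → ℝ := Sum.elim 0 (Sum.elim 1 0)
  let g : (Fin r ⊕ Fin r) ⊕ (Fin m ⊕ Fin m) → ℝ := Sum.elim 0 (Sum.elim 0 1)
  refine (spectralGap_le _ ((div_le_one hden).2 (by linarith)) (f := f) (g := g) ?_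
    fun a b => ?_).trans hgap
  · rw [LinearIndependent.pair_iff]
    intro a b hab
    have ha := congrFun hab (Sum.inr (Sum.inl i₀))
    have hb := congrFun hab (Sum.inr (Sum.inr i₀))
    exact ⟨by simpa [f, g] using ha, by simpa [f, g] using hb⟩
  · have hsum : ∀ (i : Fin m) (t : ℝ), (∑ j, if i = j then 0 else t) = ((m : ℝ) - 1) * t := by
      intro i t
      rw [← Finset.sum_erase _ (a := i) (by simp), Finset.sum_congr rfl
        (g := fun _ => t) fun j hj => if_neg (Finset.ne_of_mem_erase hj).symm]
      have : 1 ≤ m := by omega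
      simp [Finset.card_erase_of_mem, this]
    let h : (Fin r ⊕ Fin r) ⊕ (Fin m ⊕ Fin m) → ℝ := Sum.elim 0 (Sum.elim (fun _ => a) fun _ => b)
    have hfun : a • f + b • g = h := by
      ext ((v | v) | (v | v)) <;> simp [f, g, h]
    rw [hfun]
    have hform : h ⬝ᵥ ((lollipop r m)ᶜ.adjMatrix ℝ *ᵥ h) =
        m * (((m : ℝ) - 1) * a ^ 2) + m * (((m : ℝ) - 1) * b ^ 2) := by
      simp only [h, dotProduct, mulVec, Fintype.sum_sum_type, SimpleGraph.adjMatrix_apply,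
        Sum.elim_inl, Sum.elim_inr, Pi.zero_apply, zero_mul, Finset.sum_const_zero,
        zero_add, lollipop_compl_adj_inr_inr, ne_eq, ite_mul, one_mul]
      simp [hsum, ite_not]
      ring
    rw [hform]
    have hle : ∑ v, ((lollipop r m)ᶜ.degree v : ℝ) * h v ^ 2 ≤
        ((m : ℝ) - 1 + 2 * r) * (m * a ^ 2 + m * b ^ 2) := by
      have hA := Finset.sum_le_sum fun (i : Fin m) (_ : i ∈ Finset.univ) =>
        mul_le_mul_of_nonneg_right (degree_lollipop_compl_le r m (Sum.inl i)) (sq_nonneg a)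
      have hB := Finset.sum_le_sum fun (i : Fin m) (_ : i ∈ Finset.univ) =>
        mul_le_mul_of_nonneg_right (degree_lollipop_compl_le r m (Sum.inr i)) (sq_nonneg b)
      simp only [Finset.sum_const, Finset.card_univ, Fintype.card_fin, nsmul_eq_mul] at hA hB
      simp only [h, Fintype.sum_sum_type, Sum.elim_inl, Sum.elim_inr, Pi.zero_apply, mul_zero,
        zero_add, ne_eq, OfNat.ofNat_ne_zero, not_false_eq_true, zero_pow, Finset.sum_const_zero]
      linarith
    refine (mul_le_mul_of_nonneg_left hle hc0).trans_eq ?_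
    rw [← mul_assoc, div_mul_cancel₀ _ hden.ne']
    ring
end
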